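/- Let (W,S) be a finite Coxeter system and I,J ⊆ S with I ∼_W J. Then: (1) for every conjugacy class C of W, |X_I ∩ C| = |X_J ∩ C|; (2) for every Coxeter class λ of (W,S), |X_I ∩ C(λ)| = |X_J ∩ C(λ)|, where C(λ) is the λ-set. -/

import Mathlib

open scoped Classical

variable {B : Type*} {W : Type*} [Group W] {M : CoxeterMatrix B}

/-- The parabolic subgroup `W_I` generated by the simple reflections indexed by `I`. -/
def parabolic (cs : CoxeterSystem M W) (I : Set B) : Subgroup W :=
  Subgroup.closure (cs.simple '' I)

/-- `X_I`: minimal length coset representatives of `W / W_I`. -/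
def minReps (cs : CoxeterSystem M W) (I : Set B) : Set W :=
  {w : W | ∀ i ∈ I, cs.length w < cs.length (w * cs.simple i)}

/-- `I ∼_W J`: the subsets of simple reflections are conjugate under `W`. -/
def ConjSubsets (cs : CoxeterSystem M W) (I J : Set B) : Prop :=
  ∃ w : W, (fun x => w * x * w⁻¹) '' (cs.simple '' I) = cs.simple '' J

theorem conjSubsets_equivalence (cs : CoxeterSystem M W) : Equivalence (ConjSubsets cs) where
  refl I := ⟨1, by simp⟩
  symm := by
    rintro I J ⟨w, h⟩
    refine ⟨w⁻¹, ?_⟩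
    rw [← h, Set.image_image]
    simp [mul_assoc]
  trans := by
    rintro I J K ⟨w, h⟩ ⟨v, h'⟩
    refine ⟨v * w, ?_⟩
    rw [← h', ← h]
    simp [Set.image_image, mul_assoc]

/-- The setoid of Coxeter classes. -/
def coxSetoid (cs : CoxeterSystem M W) : Setoid (Set B) :=
  ⟨ConjSubsets cs, conjSubsets_equivalence cs⟩

/-- The set of Coxeter classes `Λ(W)`. -/
def CoxeterClass (cs : CoxeterSystem M W) := Quotient (coxSetoid cs)

/-- `C` is a conjugacy class of the parabolic subgroup `W_I`. -/
def IsConjClassOfParabolic (cs : CoxeterSystem M W) (I : Set B) (C : Set W) : Prop :=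
  ∃ v ∈ parabolic cs I, C = {x : W | ∃ u ∈ parabolic cs I, u * v * u⁻¹ = x}

/-- `C` is an `I`-cuspidal class: a conjugacy class of `W_I` meeting no proper
parabolic subgroup of `W_I`. -/
def IsCuspidalClass (cs : CoxeterSystem M W) (I : Set B) (C : Set W) : Prop :=
  IsConjClassOfParabolic cs I C ∧ ∀ K : Set B, K ⊂ I → C ∩ (parabolic cs K : Set W) = ∅

/-- `w` is an `I`-element: `C(w) ∩ W_I` is an `I`-cuspidal class. -/
def IsElementOf (cs : CoxeterSystem M W) (I : Set B) (w : W) : Prop :=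
  IsCuspidalClass cs I ({x : W | IsConj w x} ∩ (parabolic cs I : Set W))

/-- The λ-set `C(λ)` of the Coxeter class of `I`: the set of `λ(I)`-elements. -/
def lambdaSet (cs : CoxeterSystem M W) (I : Set B) : Set W :=
  {w : W | ∃ J : Set B, ConjSubsets cs I J ∧ IsElementOf cs J w}

/-- The λ-set of a Coxeter class. -/
def lambdaSetQ (cs : CoxeterSystem M W) (lam : CoxeterClass cs) : Set W :=
  {w : W | ∃ I : Set B, Quotient.mk (coxSetoid cs) I = lam ∧ IsElementOf cs I w}

/-- The induced character `1_{W_I}^W` of the trivial character of `W_I`,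
as a `ℚ`-valued function on `W`. -/
noncomputable def indTriv (cs : CoxeterSystem M W) (I : Set B) : W → ℚ :=
  fun w => (Nat.card {g : W | g ∈ minReps cs I ∧ g⁻¹ * w * g ∈ parabolic cs I} : ℚ)

/-! ### The inversion cocycle -/

/-- The action of the `i`-th simple reflection on functions `W → ZMod 2` recording, for each
reflection, on which side of its wall a chamber lies. -/
noncomputable def simpleFlip (cs : CoxeterSystem M W) (i : B) : Function.End (W → ZMod 2) :=
  fun a t => a (cs.simple i * t * cs.simple i) + if t = cs.simple i then 1 else 0

theorem simple_mul_pow_inv (cs : CoxeterSystem M W) (i j : B) (k : ℕ) :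
    cs.simple i * ((cs.simple i * cs.simple j) ^ k)⁻¹
      = (cs.simple i * cs.simple j) ^ k * cs.simple i := by
  induction k with
  | zero => simp
  | succ k ih =>
    rw [pow_succ', mul_inv_rev, ← mul_assoc, ih, ← pow_succ', pow_succ]
    simp [mul_assoc]

theorem simpleFlip_mul_pow_apply (cs : CoxeterSystem M W) (i j : B) (n : ℕ) (a : W → ZMod 2)
    (t : W) :
    ((simpleFlip cs i * simpleFlip cs j) ^ n) a t
      = a (((cs.simple i * cs.simple j) ^ n)⁻¹ * t * (cs.simple i * cs.simple j) ^ n)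
        + ∑ k ∈ Finset.range (2 * n),
          if t = (cs.simple i * cs.simple j) ^ k * cs.simple i then 1 else 0 := by
  induction n generalizing a with
  | zero => simp only [pow_zero, mul_zero, Finset.range_zero, Finset.sum_empty]; simp; rfl
  | succ n ih =>
    have key : ((simpleFlip cs i * simpleFlip cs j) ^ (n + 1)) a
        = ((simpleFlip cs i * simpleFlip cs j) ^ n)
          (simpleFlip cs i (simpleFlip cs j a)) := by
      rw [pow_succ]; rfl
    rw [key, ih]
    set r := cs.simple i * cs.simple j with hr
    have e1 : ((r ^ n)⁻¹ * t * r ^ n = cs.simple i) ↔ t = r ^ (2 * n) * cs.simple i := by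
      have : r ^ (2 * n) * cs.simple i = r ^ n * cs.simple i * (r ^ n)⁻¹ := by
        rw [mul_assoc, simple_mul_pow_inv, ← mul_assoc, ← pow_add, two_mul]
      rw [this, eq_mul_inv_iff_mul_eq, ← inv_mul_eq_iff_eq_mul, mul_assoc]
    have e2 : (cs.simple i * ((r ^ n)⁻¹ * t * r ^ n) * cs.simple i = cs.simple j) ↔
        t = r ^ (2 * n + 1) * cs.simple i := by
      have : r ^ (2 * n + 1) * cs.simple i
          = r ^ n * (cs.simple i * cs.simple j * cs.simple i) * (r ^ n)⁻¹ := by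
        rw [mul_assoc, mul_assoc (cs.simple i * cs.simple j), simple_mul_pow_inv, ← hr,
          ← mul_assoc, ← mul_assoc, ← pow_succ, ← pow_add]
        congr 2; ring
      rw [this, eq_mul_inv_iff_mul_eq, ← inv_mul_eq_iff_eq_mul]
      constructor
      · intro h; rw [← h]; simp [mul_assoc]
      · intro h; rw [mul_assoc (r ^ n)⁻¹, h]; simp [mul_assoc]
    have e3 : cs.simple j * (cs.simple i * ((r ^ n)⁻¹ * t * r ^ n) * cs.simple i) * cs.simple j
        = (r ^ (n + 1))⁻¹ * t * r ^ (n + 1) := by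
      rw [pow_succ]; simp [hr, mul_assoc]
    have e4 : 2 * (n + 1) = 2 * n + 1 + 1 := by ring
    simp only [simpleFlip, e1, e2, e3]
    rw [e4, Finset.sum_range_succ, Finset.sum_range_succ]
    ring

theorem simpleFlip_isLiftable (cs : CoxeterSystem M W) : M.IsLiftable (simpleFlip cs) := by
  intro i j
  funext a t
  rw [simpleFlip_mul_pow_apply, cs.simple_mul_simple_pow, two_mul, Finset.sum_range_add]
  simp only [pow_add, cs.simple_mul_simple_pow, one_mul, CharTwo.add_self_eq_zero]
  simp
  rfl

/-- `side cs w t` is `1` if the reflection `t` separates `1` from `w`, and `0` otherwise. -/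
noncomputable def side (cs : CoxeterSystem M W) (w : W) : W → ZMod 2 :=
  cs.lift ⟨simpleFlip cs, simpleFlip_isLiftable cs⟩ w 0

theorem side_one (cs : CoxeterSystem M W) (t : W) : side cs 1 t = 0 := by
  simp only [side, map_one]; rfl

theorem side_simple_mul (cs : CoxeterSystem M W) (i : B) (w t : W) :
    side cs (cs.simple i * w) t = side cs w (cs.simple i * t * cs.simple i)
      + if t = cs.simple i then 1 else 0 := by
  simp only [side, map_mul, cs.lift_apply_simple]; rfl

theorem side_simple (cs : CoxeterSystem M W) (i : B) (t : W) :
    side cs (cs.simple i) t = if t = cs.simple i then 1 else 0 := by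
  simpa [side_one] using side_simple_mul cs i 1 t

theorem side_mul (cs : CoxeterSystem M W) (x y t : W) :
    side cs (x * y) t = side cs y (x⁻¹ * t * x) + side cs x t := by
  induction x using cs.simple_induction_left generalizing t with
  | one => simp [side_one]
  | mul_simple_left w i ih =>
    rw [mul_assoc, side_simple_mul, ih, side_simple_mul]
    simp [mul_assoc, add_assoc]

theorem side_wordProd (cs : CoxeterSystem M W) (ω : List B) (t : W) :
    side cs (cs.wordProd ω) t = ((cs.leftInvSeq ω).count t : ZMod 2) := by
  induction ω generalizing t with
  | nil => simp [side_one]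
  | cons i ω ih =>
    rw [cs.wordProd_cons, side_simple_mul, ih, CoxeterSystem.leftInvSeq, List.count_cons]
    have : t = MulAut.conj (cs.simple i) (cs.simple i * t * cs.simple i) := by
      simp [mul_assoc]
    conv_rhs => rw [this]
    rw [List.count_map_of_injective _ _ (MulEquiv.injective _), ← this]
    push_cast
    congr 1
    simp only [beq_iff_eq, eq_comm (a := t)]

theorem mem_leftInvSeq_of_side_ne_zero (cs : CoxeterSystem M W) {ω : List B} {t : W}
    (h : side cs (cs.wordProd ω) t ≠ 0) : t ∈ cs.leftInvSeq ω := by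
  by_contra hn
  rw [side_wordProd, List.count_eq_zero_of_not_mem hn] at h
  simp at h

theorem length_mul_lt_of_side_ne_zero (cs : CoxeterSystem M W) {w t : W}
    (h : side cs w t ≠ 0) : cs.length (t * w) < cs.length w := by
  obtain ⟨ω, hω, rfl⟩ := cs.exists_isReduced w
  exact (cs.isLeftInversion_of_mem_leftInvSeq hω (mem_leftInvSeq_of_side_ne_zero cs h)).2

theorem side_simple_eq_zero_iff (cs : CoxeterSystem M W) (w : W) (i : B) :
    side cs w (cs.simple i) = 0 ↔ cs.length w < cs.length (cs.simple i * w) := by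
  constructor
  · intro h
    have h' : side cs (cs.simple i * w) (cs.simple i) ≠ 0 := by
      rw [side_simple_mul]; simp [h]
    simpa using length_mul_lt_of_side_ne_zero cs h'
  · intro h
    by_contra hn
    exact lt_asymm h (length_mul_lt_of_side_ne_zero cs hn)

theorem eq_one_of_side_eq_zero (cs : CoxeterSystem M W) {w : W} (h : ∀ t, side cs w t = 0) :
    w = 1 := by
  by_contra hw
  obtain ⟨i, hi⟩ := cs.exists_leftDescent_of_ne_one hw
  exact lt_asymm hi ((side_simple_eq_zero_iff cs w i).1 (h _))

theorem side_injective (cs : CoxeterSystem M W) : Function.Injective (side cs) := by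
  intro h h' e
  have : h⁻¹ * h' = 1 := eq_one_of_side_eq_zero cs fun t => by
    have h1 := side_mul cs h (h⁻¹ * h') (h * t * h⁻¹)
    rw [mul_inv_cancel_left, ← e] at h1
    simpa [mul_assoc] using h1
  exact inv_mul_eq_one.1 this

/-! ### Projection onto a standard parabolic subgroup -/

theorem simple_mem_parabolic (cs : CoxeterSystem M W) {I : Set B} {i : B} (hi : i ∈ I) :
    cs.simple i ∈ parabolic cs I :=
  Subgroup.subset_closure ⟨i, hi, rfl⟩

theorem exists_word_of_mem_parabolic (cs : CoxeterSystem M W) {I : Set B} {u : W}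
    (hu : u ∈ parabolic cs I) : ∃ ω : List B, (∀ i ∈ ω, i ∈ I) ∧ cs.wordProd ω = u := by
  induction hu using Subgroup.closure_induction with
  | mem x hx =>
    obtain ⟨i, hi, rfl⟩ := hx
    exact ⟨[i], by simpa using hi, by simp⟩
  | one => exact ⟨[], by simp, by simp⟩
  | mul x y _ _ hx hy =>
    obtain ⟨ω, h1, rfl⟩ := hx
    obtain ⟨ω', h2, rfl⟩ := hy
    refine ⟨ω ++ ω', fun i hi => ?_, cs.wordProd_append _ _⟩
    rcases List.mem_append.1 hi with h | h
    exacts [h1 i h, h2 i h]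
  | inv x _ hx =>
    obtain ⟨ω, h1, rfl⟩ := hx
    exact ⟨ω.reverse, by simpa using h1, cs.wordProd_reverse _⟩

theorem side_eq_zero_of_notMem_parabolic (cs : CoxeterSystem M W) {I : Set B} {u t : W}
    (hu : u ∈ parabolic cs I) (ht : t ∉ parabolic cs I) : side cs u t = 0 := by
  induction hu using Subgroup.closure_induction generalizing t with
  | mem x hx =>
    obtain ⟨i, hi, rfl⟩ := hx
    rw [side_simple, if_neg]
    rintro rfl
    exact ht (simple_mem_parabolic cs hi)
  | one => exact side_one cs t
  | mul x y hx' _ hx hy =>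
    rw [side_mul, hx ht, hy, add_zero]
    rwa [(parabolic cs I).mul_mem_cancel_right hx',
      (parabolic cs I).mul_mem_cancel_left (inv_mem hx')]
  | inv x hx' hx =>
    have h := side_mul cs x x⁻¹ (x * t * x⁻¹)
    rw [mul_inv_cancel, side_one, hx] at h
    · simpa [mul_assoc] using h.symm
    · rwa [(parabolic cs I).mul_mem_cancel_right (inv_mem hx'),
        (parabolic cs I).mul_mem_cancel_left hx']

theorem eq_one_of_mem_parabolic_of_side_simple_eq_zero (cs : CoxeterSystem M W) {I : Set B}
    {u : W} (hu : u ∈ parabolic cs I) (h : ∀ i ∈ I, side cs u (cs.simple i) = 0) : u = 1 := by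
  have hex : ∃ n, ∃ ω : List B, ω.length = n ∧ (∀ i ∈ ω, i ∈ I) ∧ cs.wordProd ω = u := by
    obtain ⟨ω, h1, h2⟩ := exists_word_of_mem_parabolic cs hu
    exact ⟨_, ω, rfl, h1, h2⟩
  obtain ⟨ω, hn, hI, hω⟩ := Nat.find_spec hex
  cases ω with
  | nil => simpa using hω.symm
  | cons i ω =>
    exfalso
    have h1 := h i (hI i (by simp))
    rw [← hω, cs.wordProd_cons, side_simple_mul] at h1
    have h2 : side cs (cs.wordProd ω) (cs.simple i) ≠ 0 := by
      intro h0
      simp [h0] at h1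
    obtain ⟨j, hj, hji⟩ := List.mem_iff_getElem.1 (mem_leftInvSeq_of_side_ne_zero cs h2)
    have h3 := cs.getD_leftInvSeq_mul_wordProd ω j
    rw [List.getD_eq_getElem _ 1 hj, hji, ← cs.wordProd_cons, hω] at h3
    rw [cs.length_leftInvSeq] at hj
    refine Nat.find_min hex (m := (ω.eraseIdx j).length) ?_ ⟨_, rfl, ?_, h3.symm⟩
    · rw [← hn, List.length_cons, List.length_eraseIdx_of_lt hj]; omega
    · intro k hk
      exact hI k (List.mem_cons_of_mem _ (List.mem_of_mem_eraseIdx hk))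

theorem exists_parabolic_factor (cs : CoxeterSystem M W) (I : Set B) (v : W) :
    ∃ u ∈ parabolic cs I, ∀ t ∈ parabolic cs I, side cs (u⁻¹ * v) t = 0 := by
  have hex : ∃ n, ∃ u ∈ parabolic cs I, cs.length (u⁻¹ * v) = n := ⟨_, 1, one_mem _, rfl⟩
  obtain ⟨u, hu, hn⟩ := Nat.find_spec hex
  refine ⟨u, hu, fun t ht => ?_⟩
  by_contra h
  refine Nat.find_min hex (m := cs.length (t * (u⁻¹ * v))) ?_
    ⟨u * t⁻¹, mul_mem hu (inv_mem ht), by simp [mul_assoc]⟩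
  rw [← hn]
  exact length_mul_lt_of_side_ne_zero cs h

/-- The projection of the chamber `v` onto the residue `W_I`. -/
noncomputable def parabolicProj (cs : CoxeterSystem M W) (I : Set B) (v : W) : W :=
  (exists_parabolic_factor cs I v).choose

theorem parabolicProj_mem (cs : CoxeterSystem M W) (I : Set B) (v : W) :
    parabolicProj cs I v ∈ parabolic cs I :=
  (exists_parabolic_factor cs I v).choose_spec.1

theorem side_parabolicProj_inv_mul (cs : CoxeterSystem M W) (I : Set B) (v : W) {t : W}
    (ht : t ∈ parabolic cs I) : side cs ((parabolicProj cs I v)⁻¹ * v) t = 0 :=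
  (exists_parabolic_factor cs I v).choose_spec.2 t ht

theorem side_parabolicProj (cs : CoxeterSystem M W) (I : Set B) (v : W) {t : W}
    (ht : t ∈ parabolic cs I) : side cs (parabolicProj cs I v) t = side cs v t := by
  have h := side_mul cs (parabolicProj cs I v) ((parabolicProj cs I v)⁻¹ * v) t
  have hp := parabolicProj_mem cs I v
  rw [side_parabolicProj_inv_mul cs I v (mul_mem (mul_mem (inv_mem hp) ht) hp), zero_add,
    mul_inv_cancel_left] at h
  exact h.symm

theorem parabolicProj_eq_iff (cs : CoxeterSystem M W) (I : Set B) (v u : W) :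
    parabolicProj cs I v = u ↔ u ∈ parabolic cs I ∧ (u⁻¹ * v)⁻¹ ∈ minReps cs I := by
  have hX : ∀ y : W, y⁻¹ ∈ minReps cs I ↔ ∀ i ∈ I, side cs y (cs.simple i) = 0 := by
    intro y
    refine forall₂_congr fun i _ => ?_
    rw [side_simple_eq_zero_iff, cs.length_inv, ← cs.length_inv (y⁻¹ * cs.simple i)]
    simp
  rw [hX]
  constructor
  · rintro rfl
    exact ⟨parabolicProj_mem cs I v, fun i hi =>
      side_parabolicProj_inv_mul cs I v (simple_mem_parabolic cs hi)⟩
  · rintro ⟨hu, h⟩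
    have hp := parabolicProj_mem cs I v
    have : u⁻¹ * parabolicProj cs I v = 1 := by
      refine eq_one_of_mem_parabolic_of_side_simple_eq_zero cs (mul_mem (inv_mem hu) hp)
        fun i hi => ?_
      have e := side_mul cs (u⁻¹ * parabolicProj cs I v)
        ((parabolicProj cs I v)⁻¹ * v) (cs.simple i)
      have hq := mul_mem (inv_mem hu) hp
      rw [side_parabolicProj_inv_mul cs I v
        (mul_mem (mul_mem (inv_mem hq) (simple_mem_parabolic cs hi)) hq), zero_add] at e
      rw [← e, mul_assoc, mul_inv_cancel_left]
      exact h i hi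
    exact (inv_mul_eq_one.1 this).symm

/-! ### Face operators -/

/-- `f` preserves the side of the walls in `R` and prescribes the side of all other walls, as
the projection onto a face with set of walls `R` does. -/
def IsFaceOperator (cs : CoxeterSystem M W) (f : W → W) (R : Set W) : Prop :=
  (∀ t ∈ R, ∀ h, side cs (f h) t = side cs h t) ∧
    ∀ t ∉ R, ∀ h h', side cs (f h) t = side cs (f h') t

theorem isFaceOperator_parabolicProj (cs : CoxeterSystem M W) (I : Set B) :
    IsFaceOperator cs (parabolicProj cs I) (parabolic cs I) := by
  refine ⟨fun t ht h => side_parabolicProj cs I h ht, fun t ht h h' => ?_⟩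
  rw [side_eq_zero_of_notMem_parabolic cs (parabolicProj_mem cs I h) ht,
    side_eq_zero_of_notMem_parabolic cs (parabolicProj_mem cs I h') ht]

namespace IsFaceOperator

variable {cs : CoxeterSystem M W} {f g : W → W} {R R' : Set W}

theorem apply_apply (hf : IsFaceOperator cs f R) (hg : IsFaceOperator cs g R') (hR : R ⊆ R')
    (h : W) : f (g h) = f h := by
  apply side_injective cs
  funext t
  by_cases ht : t ∈ R
  · rw [hf.1 t ht, hg.1 t (hR ht), hf.1 t ht]
  · exact hf.2 t ht _ _

theorem comp (hf : IsFaceOperator cs f R) (hg : IsFaceOperator cs g R') :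
    IsFaceOperator cs (f ∘ g) (R ∩ R') := by
  refine ⟨fun t ht h => ?_, fun t ht h h' => ?_⟩
  · simp [hf.1 t ht.1, hg.1 t ht.2]
  · by_cases hR : t ∈ R
    · simp only [Function.comp_apply, hf.1 t hR]
      exact hg.2 t (fun h => ht ⟨hR, h⟩) _ _
    · exact hf.2 t hR _ _

theorem conj (hf : IsFaceOperator cs f R) (w : W) :
    IsFaceOperator cs (fun h => w * f (w⁻¹ * h)) {t | w⁻¹ * t * w ∈ R} := by
  refine ⟨fun t ht h => ?_, fun t ht h h' => ?_⟩
  · rw [side_mul, hf.1 _ ht, ← side_mul, mul_inv_cancel_left]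
  · rw [side_mul, side_mul, hf.2 _ ht]

end IsFaceOperator

/-- The number of fixed points of `f`, i.e. the trace of its linearization. -/
noncomputable def fixCard {α : Type*} (f : α → α) : ℕ := Nat.card {h // f h = h}

theorem fixCard_comp_comm {α : Type*} (f g : α → α) : fixCard (f ∘ g) = fixCard (g ∘ f) :=
  Nat.card_congr
    { toFun := fun x => ⟨g x.1, congrArg g x.2⟩
      invFun := fun x => ⟨f x.1, congrArg f x.2⟩
      left_inv := fun x => Subtype.ext x.2
      right_inv := fun x => Subtype.ext x.2 }

theorem exists_isFaceOperator_forall_le (cs : CoxeterSystem M W) {p : W → W} {R : Set W}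
    (hp : IsFaceOperator cs p R) (w : W) (n : ℕ) :
    ∃ a, IsFaceOperator cs a {t | ∀ i ≤ n, (w ^ i)⁻¹ * t * w ^ i ∈ R} ∧
      fixCard (a ∘ (w * ·)) = fixCard (p ∘ (w * ·)) := by
  induction n with
  | zero => exact ⟨p, by simpa using hp, rfl⟩
  | succ n ih =>
    obtain ⟨a, ha, hfix⟩ := ih
    refine ⟨p ∘ fun h => w * a (w⁻¹ * h), ?_, ?_⟩
    · convert hp.comp (ha.conj w) using 1
      ext t
      simp only [Set.mem_ofPred_eq, Set.mem_inter_iff]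
      have e : ∀ i, (w ^ (i + 1))⁻¹ * t * w ^ (i + 1) = (w ^ i)⁻¹ * (w⁻¹ * t * w) * w ^ i := by
        intro i; simp [pow_succ', mul_assoc]
      constructor
      · intro h
        exact ⟨by simpa using h 0 (by omega), fun i hi => e i ▸ h (i + 1) (by omega)⟩
      · rintro ⟨h0, h⟩ i hi
        cases i with
        | zero => simpa using h0
        | succ i => rw [e]; exact h i (by omega)
    · have e1 : (p ∘ fun h => w * a (w⁻¹ * h)) ∘ (w * ·) = (p ∘ (w * ·)) ∘ a := by
        funext h; simp
      have e2 : a ∘ (p ∘ (w * ·)) = a ∘ (w * ·) := by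
        funext h
        exact ha.apply_apply hp (fun t ht => by simpa using ht 0 (by omega)) _
      rw [e1, fixCard_comp_comm, e2, hfix]

theorem exists_isFaceOperator_forall [Finite W] (cs : CoxeterSystem M W) {p : W → W}
    {R : Set W} (hp : IsFaceOperator cs p R) (w : W) :
    ∃ a, IsFaceOperator cs a {t | ∀ i : ℕ, (w ^ i)⁻¹ * t * w ^ i ∈ R} ∧
      fixCard (a ∘ (w * ·)) = fixCard (p ∘ (w * ·)) := by
  obtain ⟨a, ha, hfix⟩ := exists_isFaceOperator_forall_le cs hp w (orderOf w)
  refine ⟨a, ?_, hfix⟩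
  convert ha using 1
  ext t
  refine ⟨fun h i _ => h i, fun h i => ?_⟩
  rw [← pow_mod_orderOf]
  exact h _ (Nat.mod_lt _ (orderOf_pos w)).le

theorem IsFaceOperator.fixCard_eq [Finite W] {cs : CoxeterSystem M W} {p q : W → W} {R : Set W}
    (hp : IsFaceOperator cs p R) (hq : IsFaceOperator cs q R) (w : W) :
    fixCard (p ∘ (w * ·)) = fixCard (q ∘ (w * ·)) := by
  obtain ⟨a, ha, hap⟩ := exists_isFaceOperator_forall cs hp w
  obtain ⟨b, hb, hbq⟩ := exists_isFaceOperator_forall cs hq w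
  rw [← hap, ← hbq]
  have e1 : a ∘ (w * ·) = a ∘ (b ∘ (w * ·)) := by
    funext h; exact (ha.apply_apply hb subset_rfl _).symm
  have e2 : (b ∘ (w * ·)) ∘ a = b ∘ (w * ·) := by
    funext h
    have := hb.apply_apply (ha.conj w) (fun t ht i => by
      simpa [pow_succ', mul_assoc] using ht (i + 1)) (w * h)
    simpa using this
  rw [e1, fixCard_comp_comm, e2]

/-! ### Counting -/

theorem card_sigma_fixed_eq (cs : CoxeterSystem M W) (I : Set B) {C : Set W}
    (hC : ∀ x ∈ C, ∀ g : W, g * x * g⁻¹ ∈ C) :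
    Nat.card (Σ w : {w : W // w⁻¹ ∈ C}, {h // (parabolicProj cs I ∘ (w.1 * ·)) h = h})
      = Nat.card (parabolic cs I) * Nat.card (minReps cs I ∩ C : Set W) := by
  rw [← Nat.card_prod]
  refine Nat.card_congr
    { toFun := fun x => ⟨⟨x.2.1, ((parabolicProj_eq_iff cs I _ _).1 x.2.2).1⟩,
        ⟨(x.2.1⁻¹ * (x.1.1 * x.2.1))⁻¹, ((parabolicProj_eq_iff cs I _ _).1 x.2.2).2, ?_⟩⟩
      invFun := fun y => ⟨⟨y.1.1 * y.2.1⁻¹ * y.1.1⁻¹, ?_⟩, ⟨y.1.1, ?_⟩⟩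
      left_inv := ?_
      right_inv := ?_ }
  · simpa [mul_assoc] using hC _ x.1.2 x.2.1⁻¹
  · simpa [mul_assoc] using hC _ y.2.2.2 y.1.1
  · exact (parabolicProj_eq_iff cs I _ _).2 ⟨y.1.2, by simpa [mul_assoc] using y.2.2.1⟩
  · rintro ⟨⟨w, hw⟩, ⟨h, hh⟩⟩
    have e : h * (h⁻¹ * (w * h))⁻¹⁻¹ * h⁻¹ = w := by group
    refine Sigma.ext (Subtype.ext e) ?_
    refine (Subtype.heq_iff_coe_eq fun k => ?_).2 rfl
    exact iff_of_eq (congrArg (fun x => parabolicProj cs I (x * k) = k) e)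
  · rintro ⟨⟨u, hu⟩, ⟨x, hx⟩⟩
    simp [mul_assoc]

theorem card_minReps_inter_eq [Finite W] (cs : CoxeterSystem M W) {I J : Set B}
    (hIJ : ConjSubsets cs I J) {C : Set W} (hC : ∀ x ∈ C, ∀ g : W, g * x * g⁻¹ ∈ C) :
    Nat.card (minReps cs I ∩ C : Set W) = Nat.card (minReps cs J ∩ C : Set W) := by
  obtain ⟨g, hg⟩ := hIJ
  have hmap : (parabolic cs I).map (MulAut.conj g).toMonoidHom = parabolic cs J := by
    rw [parabolic, MonoidHom.map_closure, parabolic, ← hg]; rfl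
  have hcard : Nat.card (parabolic cs I) = Nat.card (parabolic cs J) := by
    rw [← hmap]
    exact Nat.card_congr (Subgroup.equivMapOfInjective _ _ (MulEquiv.injective _)).toEquiv
  have hq : IsFaceOperator cs (fun h => g⁻¹ * parabolicProj cs J (g⁻¹⁻¹ * h))
      (parabolic cs I) := by
    convert (isFaceOperator_parabolicProj cs J).conj g⁻¹ using 1
    ext t
    rw [← hmap]
    simp [mul_assoc]
  apply Nat.eq_of_mul_eq_mul_left (Nat.card_pos (α := parabolic cs I))
  rw [← card_sigma_fixed_eq cs I hC]
  conv_rhs => rw [hcard]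
  rw [← card_sigma_fixed_eq cs J hC]
  have : ∀ w : {w : W // w⁻¹ ∈ C},
      Nat.card {h // (parabolicProj cs I ∘ (w.1 * ·)) h = h}
        = Nat.card {h // (parabolicProj cs J ∘ ((g * w.1 * g⁻¹) * ·)) h = h} := by
    intro w
    refine ((isFaceOperator_parabolicProj cs I).fixCard_eq hq w.1).trans ?_
    refine Nat.card_congr ((Equiv.mulLeft g).subtypeEquiv fun h => ?_)
    simp [inv_mul_eq_iff_eq_mul, mul_assoc]
  have hconj : ∀ w : W, w⁻¹ ∈ C ↔ (MulAut.conj g w)⁻¹ ∈ C := by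
    intro w
    constructor
    · intro h; simpa [mul_assoc] using hC _ h g
    · intro h; simpa [mul_assoc] using hC _ h g⁻¹
  exact Nat.card_congr (Equiv.sigmaCongr ((MulAut.conj g).toEquiv.subtypeEquiv hconj)
    fun w => (Finite.card_eq.1 (this w)).some)

theorem setOf_isConj_conj (w g : W) : {x : W | IsConj (g * w * g⁻¹) x} = {x | IsConj w x} := by
  have h : IsConj w (g * w * g⁻¹) := isConj_iff.2 ⟨g, rfl⟩
  ext x
  exact ⟨h.trans, h.symm.trans⟩

/-- If `I ∼_W J` then `X_I` and `X_J` meet every conjugacy class, and every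
λ-set, in the same number of elements. -/
theorem statement3 [Fintype W] (cs : CoxeterSystem M W) (I J : Set B)
    (h : ConjSubsets cs I J) :
    (∀ v : W, Nat.card (minReps cs I ∩ {x : W | IsConj v x} : Set W)
        = Nat.card (minReps cs J ∩ {x : W | IsConj v x} : Set W)) ∧
    (∀ lam : CoxeterClass cs, Nat.card (minReps cs I ∩ lambdaSetQ cs lam : Set W)
        = Nat.card (minReps cs J ∩ lambdaSetQ cs lam : Set W)) := by
  refine ⟨fun v => card_minReps_inter_eq cs h fun x hx g => ?_,
    fun lam => card_minReps_inter_eq cs h ?_⟩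
  · exact IsConj.trans hx (isConj_iff.2 ⟨g, rfl⟩)
  · rintro x ⟨K, hK, hx⟩ g
    refine ⟨K, hK, ?_⟩
    rwa [IsElementOf, setOf_isConj_conj]
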